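/- arXiv:1101.5001 — 4 statements merged into one kernel-verified Lean document; each statement's English description precedes it below -/
import Mathlib

section
/- Let $h$ be a positive integer, $A$, $B$ finite non-empty sets in a commutative group with $|A| = m$ and $|A+B| = n$, and let $\alpha_1 = \min_{\emptyset \ne Z \subseteq A} |Z+B|/|Z|$. Then for every real $t$ with $0 \le t < m$ there exists a non-empty subset $X \subseteq A$ with $|X| > t$ such that $|X + hB| \le \alpha_1^h\, t + (|X| - t) \left(\frac{n - \alpha_1 t}{m - t}\right)^h$. -/
open Pointwise

/-- `iterSum B k` is the `k`-fold iterated sumset `B + ⋯ + B` (`k` times),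
with the convention `iterSum B 0 = {0}`. -/
def iterSum {G : Type*} [AddCommGroup G] [DecidableEq G] (B : Finset G) : ℕ → Finset G
  | 0 => {0}
  | k + 1 => iterSum B k + B

/-- A Petridis-type inequality relative to a subset `Y` of `X`: if passing from any intermediate
set `Z` to `X` adds at most `K * (|X| - |Z|)` elements to the sumset with `B`, then the same holds
for `X + C` relative to `Y + C`. -/
theorem card_add_add_sub_le {G : Type*} [AddCommGroup G] [DecidableEq G]
    {X Y B : Finset G} {K : ℝ} (hYX : Y ⊆ X)
    (hX : ∀ Z, Y ⊆ Z → Z ⊆ X →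
      ((X + B).card : ℝ) - (Z + B).card ≤ K * ((X.card : ℝ) - Z.card))
    (C : Finset G) :
    ((X + C + B).card : ℝ) - (Y + C + B).card ≤
      K * (((X + C).card : ℝ) - (Y + C).card) := by
  have mem_add_single : ∀ {S : Finset G} {c g : G}, g ∈ S + {c} ↔ ∃ x ∈ S, x + c = g := by
    simp [Finset.mem_add]
  have key : ∀ D : Finset G, D ⊆ C →
      (((Y + C) ∪ (X + D) + B).card : ℝ) - (Y + C + B).card ≤
        K * ((((Y + C) ∪ (X + D)).card : ℝ) - (Y + C).card) := by
    intro D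
    induction D using Finset.induction_on with
    | empty => intro _; simp
    | insert c D _ ih =>
      intro hD
      rw [Finset.insert_subset_iff] at hD
      have ih := ih hD.2
      set S := (Y + C) ∪ (X + D) with hS
      set Z := X.filter (fun x => x + c ∈ S) with hZ
      have hZX : Z ⊆ X := Finset.filter_subset _ _
      have hYZ : Y ⊆ Z := fun y hy => Finset.mem_filter.2
        ⟨hYX hy, Finset.mem_union_left _ (Finset.add_mem_add hy hD.1)⟩
      have hSeq : (Y + C) ∪ (X + insert c D) = S ∪ ((X \ Z) + {c}) := by
        have h1 : X + insert c D = (X + {c}) ∪ (X + D) := by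
          rw [Finset.insert_eq, Finset.add_union]
        ext g
        simp only [h1, hS, hZ, Finset.mem_union, mem_add_single,
          Finset.mem_sdiff, Finset.mem_filter]
        constructor
        · rintro (h | ⟨x, hx, rfl⟩ | h)
          · exact Or.inl (Or.inl h)
          · by_cases hm : x + c ∈ Y + C ∨ x + c ∈ X + D
            · exact Or.inl hm
            · exact Or.inr ⟨x, ⟨hx, fun h => hm h.2⟩, rfl⟩
          · exact Or.inl (Or.inr h)
        · rintro ((h | h) | ⟨x, ⟨hx, _⟩, rfl⟩)
          · exact Or.inl h
          · exact Or.inr (Or.inr h)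
          · exact Or.inr (Or.inl ⟨x, hx, rfl⟩)
      have hcard : ((S ∪ ((X \ Z) + {c})).card : ℝ) = S.card + ((X.card : ℝ) - Z.card) := by
        rw [Finset.card_union_of_disjoint, Finset.card_add_singleton, Nat.cast_add,
          Finset.cast_card_sdiff hZX]
        rw [Finset.disjoint_right]
        intro g hg hgS
        simp only [mem_add_single, Finset.mem_sdiff] at hg
        obtain ⟨x, ⟨hx, hxZ⟩, rfl⟩ := hg
        exact hxZ (Finset.mem_filter.2 ⟨hx, hgS⟩)
      have hsub : S ∪ ((X \ Z) + {c}) + B ⊆ (S + B) ∪ (((X + B) \ (Z + B)) + {c}) := by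
        intro g hg
        rw [Finset.union_add, Finset.mem_union] at hg
        rw [Finset.mem_union]
        by_cases hgS : g ∈ S + B
        · exact Or.inl hgS
        refine Or.inr ?_
        obtain ⟨u, hu, b, hb, rfl⟩ := Finset.mem_add.1 (hg.resolve_left hgS)
        simp only [mem_add_single, Finset.mem_sdiff] at hu ⊢
        obtain ⟨x, ⟨hx, -⟩, rfl⟩ := hu
        refine ⟨x + b, ⟨Finset.add_mem_add hx hb, fun hxb => hgS ?_⟩, by abel⟩
        obtain ⟨z, hz, b', hb', he⟩ := Finset.mem_add.1 hxb
        have : x + c + b = (z + c) + b' := by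
          rw [add_right_comm, ← he]; abel
        rw [this]
        exact Finset.add_mem_add (Finset.mem_filter.1 hz).2 hb'
      have hcardB : ((S ∪ ((X \ Z) + {c}) + B).card : ℝ) ≤
          (S + B).card + (((X + B).card : ℝ) - (Z + B).card) := by
        rw [← Finset.cast_card_sdiff (Finset.add_subset_add_right hZX),
          ← Finset.card_add_singleton ((X + B) \ (Z + B)) c]
        exact_mod_cast (Finset.card_le_card hsub).trans (Finset.card_union_le _ _)
      rw [hSeq, hcard]
      have := hX Z hYZ hZX
      linarith
  have h := key C subset_rfl
  rwa [Finset.union_eq_right.2 (Finset.add_subset_add_right hYX)] at h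

theorem card_add_iterSum_sub_le {G : Type*} [AddCommGroup G] [DecidableEq G]
    {X Y B : Finset G} {K : ℝ} (hK : 0 ≤ K) (hYX : Y ⊆ X)
    (hX : ∀ Z, Y ⊆ Z → Z ⊆ X →
      ((X + B).card : ℝ) - (Z + B).card ≤ K * ((X.card : ℝ) - Z.card))
    (h : ℕ) :
    ((X + iterSum B h).card : ℝ) - (Y + iterSum B h).card ≤
      K ^ h * ((X.card : ℝ) - Y.card) := by
  induction h with
  | zero => simp [iterSum]
  | succ h ih =>
    rw [iterSum, ← add_assoc, ← add_assoc]
    calc _ ≤ _ := card_add_add_sub_le hYX hX _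
      _ ≤ K * (K ^ h * ((X.card : ℝ) - Y.card)) := mul_le_mul_of_nonneg_left ih hK
      _ = _ := by ring

/-- If `X` minimises `|Z + B| - K * |Z|` among its subsets and every subset of `X` has
magnification ratio at least `α`, then `|X + hB|` is bounded by the value obtained by splitting
`X` into a part of magnification `α` and a part of magnification `K`. -/
theorem exists_card_add_iterSum_le {G : Type*} [AddCommGroup G] [DecidableEq G]
    {B : Finset G} {α K : ℝ} (hα : 0 ≤ α) (hαK : α ≤ K) (h : ℕ) (X : Finset G)
    (hαX : ∀ Z ⊆ X, α * (Z.card : ℝ) ≤ (Z + B).card)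
    (hX : ∀ Z ⊆ X, ((X + B).card : ℝ) - (Z + B).card ≤ K * ((X.card : ℝ) - Z.card)) :
    ∃ L : ℝ, α * L + K * (X.card - L) = (X + B).card ∧
      ((X + iterSum B h).card : ℝ) ≤ α ^ h * L + K ^ h * (X.card - L) := by
  induction X using Finset.strongInduction with
  | H X ih =>
    rcases X.eq_empty_or_nonempty with rfl | hne
    · exact ⟨0, by simp, by simp⟩
    obtain ⟨Y, hY, hYmax⟩ := Finset.exists_max_image X.ssubsets
      (fun Z => (((X + B).card : ℝ) - (Z + B).card) / ((X.card : ℝ) - Z.card))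
      ⟨∅, by simpa [Finset.mem_ssubsets] using hne⟩
    rw [Finset.mem_ssubsets] at hY
    have hpos : ∀ Z, Z ⊂ X → (0 : ℝ) < (X.card : ℝ) - Z.card := fun Z hZ =>
      sub_pos.2 (by exact_mod_cast Finset.card_lt_card hZ)
    obtain ⟨k, hk⟩ : ∃ k, k = (((X + B).card : ℝ) - (Y + B).card) / ((X.card : ℝ) - Y.card) :=
      ⟨_, rfl⟩
    rw [← hk] at hYmax
    have hkY : ((X + B).card : ℝ) - (Y + B).card = k * ((X.card : ℝ) - Y.card) := by
      rw [hk, div_mul_cancel₀ _ (hpos Y hY).ne']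
    have hkX : ∀ Z ⊆ X, ((X + B).card : ℝ) - (Z + B).card ≤ k * ((X.card : ℝ) - Z.card) := by
      intro Z hZ
      rcases hZ.eq_or_ssubset with rfl | hZ
      · simp
      · exact (div_le_iff₀ (hpos Z hZ)).1 (hYmax Z (Finset.mem_ssubsets.2 hZ))
    have hkK : k ≤ K := by
      rw [hk, div_le_iff₀ (hpos Y hY)]
      exact hX Y hY.1
    have hαk : α ≤ k := by
      have h1 := hkX ∅ (Finset.empty_subset _)
      have h2 := hαX X subset_rfl
      have h3 : (0 : ℝ) < X.card := by exact_mod_cast hne.card_pos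
      simp only [Finset.empty_add, Finset.card_empty, Nat.cast_zero, sub_zero] at h1
      exact le_of_mul_le_mul_right (h2.trans h1) h3
    obtain ⟨L, hL, hLh⟩ := ih Y hY (fun Z hZ => hαX Z (hZ.trans hY.1)) (fun Z hZ => by
      have h1 := hkX Z (hZ.trans hY.1)
      have h2 : (Z.card : ℝ) ≤ Y.card := by exact_mod_cast Finset.card_le_card hZ
      have h3 := mul_le_mul_of_nonneg_right hkK (sub_nonneg.2 h2)
      linarith)
    have hrel := card_add_iterSum_sub_le (hα.trans hαk) hY.1 (fun Z _ hZ => hkX Z hZ) h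
    obtain ⟨a, b, ha, hb, hab, habk⟩ : k ∈ segment ℝ α K := by
      rw [segment_eq_Icc hαK]
      exact ⟨hαk, hkK⟩
    have hconv := (convexOn_pow (𝕜 := ℝ) h).2 (Set.mem_Ici.2 hα) (Set.mem_Ici.2 (hα.trans hαK))
      ha hb hab
    simp only [smul_eq_mul] at habk hconv
    rw [habk] at hconv
    obtain rfl : b = 1 - a := by linarith
    have hd := mul_le_mul_of_nonneg_right hconv (hpos Y hY).le
    refine ⟨L + a * ((X.card : ℝ) - Y.card), ?_, ?_⟩
    · rw [← habk] at hkY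
      linear_combination hL - hkY
    · linarith

/-- Strengthened Plünnecke inequality for a large subset: with
`α₁ = min_{∅ ≠ Z ⊆ A} |Z+B|/|Z|`, for every `0 ≤ t < m` there is `X ⊆ A` with `|X| > t`
and `|X + hB| ≤ α₁^h t + (|X| - t) ((n - α₁ t)/(m - t))^h`. -/
theorem stmt_15 {G : Type*} [AddCommGroup G] [DecidableEq G]
    (h : ℕ) (hh : 0 < h)
    (A B : Finset G) (hA : A.Nonempty) (hB : B.Nonempty)
    (m n : ℕ) (hm : A.card = m) (hn : (A + B).card = n)
    (α₁ : ℝ)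
    (hα₁ : IsLeast {r : ℝ | ∃ Z ⊆ A, Z.Nonempty ∧
        r = ((Z + B).card : ℝ) / (Z.card : ℝ)} α₁)
    (t : ℝ) (ht0 : 0 ≤ t) (htm : t < m) :
    ∃ X ⊆ A, X.Nonempty ∧ t < (X.card : ℝ) ∧
      ((X + iterSum B h).card : ℝ) ≤
        α₁ ^ h * t +
          ((X.card : ℝ) - t) * (((n : ℝ) - α₁ * t) / ((m : ℝ) - t)) ^ h := by
  have hα0 : 0 ≤ α₁ := by
    obtain ⟨Z, -, -, rfl⟩ := hα₁.1
    positivity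
  have hαA : ∀ Z ⊆ A, α₁ * (Z.card : ℝ) ≤ (Z + B).card := by
    intro Z hZ
    rcases Z.eq_empty_or_nonempty with rfl | hne
    · simp
    · rw [← le_div_iff₀ (by exact_mod_cast hne.card_pos)]
      exact hα₁.2 ⟨Z, hZ, hne, rfl⟩
  have hmt : (0 : ℝ) < m - t := sub_pos.2 htm
  obtain ⟨K, hK⟩ : ∃ K, K = ((n : ℝ) - α₁ * t) / ((m : ℝ) - t) := ⟨_, rfl⟩
  rw [← hK]
  have hKmt : K * ((m : ℝ) - t) = n - α₁ * t := by rw [hK, div_mul_cancel₀ _ hmt.ne']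
  have hαK : α₁ ≤ K := by
    rw [hK, le_div_iff₀ hmt]
    have := hαA A subset_rfl
    rw [hm, hn] at this
    linarith
  obtain ⟨X, hXA, htX, hX⟩ : ∃ X ⊆ A, t < (X.card : ℝ) ∧
      ∀ Z ⊆ A, ((X + B).card : ℝ) - K * X.card ≤ (Z + B).card - K * Z.card := by
    by_cases hAmin : ∀ Z ⊆ A, ((A + B).card : ℝ) - K * A.card ≤ (Z + B).card - K * Z.card
    · exact ⟨A, subset_rfl, by rwa [hm], hAmin⟩
    push Not at hAmin
    obtain ⟨W, hWA, hW⟩ := hAmin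
    obtain ⟨X, hX, hXmin⟩ := Finset.exists_min_image A.powerset
      (fun Z => ((Z + B).card : ℝ) - K * Z.card) ⟨A, Finset.mem_powerset_self A⟩
    simp only [Finset.mem_powerset] at hX hXmin
    refine ⟨X, hX, ?_, hXmin⟩
    by_contra! hlt
    have h1 := hXmin W hWA
    have h2 := hαA X hX
    have h3 := mul_le_mul_of_nonneg_left hlt (sub_nonneg.2 hαK)
    rw [hm, hn] at hW
    linarith
  refine ⟨X, hXA, Finset.card_pos.1 (by exact_mod_cast ht0.trans_lt htX), htX, ?_⟩
  obtain ⟨L, hL, hLh⟩ := exists_card_add_iterSum_le hα0 hαK h X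
    (fun Z hZ => hαA Z (hZ.trans hXA)) (fun Z hZ => by linarith [hX Z (hZ.trans hXA)])
  have hXle := hX A subset_rfl
  rw [hm, hn] at hXle
  rcases hαK.eq_or_lt with rfl | hlt
  · linarith
  · have htL : t ≤ L := by
      refine le_of_mul_le_mul_left ?_ (sub_pos.2 hlt)
      linarith
    have hpow := mul_le_mul_of_nonneg_right (pow_le_pow_left₀ hα0 hαK h) (sub_nonneg.2 htL)
    linarith
end

section
/- Let $h \ge j \ge 1$ be integers and let $X$, $B$, $J$ be finite sets in a commutative group with $X$, $B$ non-empty and $J \cap X = \emptyset$. Let $\alpha \ge 0$ be a real with $|(X + jB) \setminus (J + jB)| = \alpha^j |X|$, and suppose that for every non-empty subset $Z \subseteq X$ one has $|(X + jB) \setminus (J + jB)| \cdot |Z| \le |(Z + jB) \setminus (J + jB)| \cdot |X|$. Then $|(X + hB) \setminus (J + hB)| \le \alpha^h |X|$. -/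
open Pointwise

/-- Layer-cake formula for a natural-number valued function on a finite set. -/
lemma sum_card_filter_lt {ι : Type*} (s : Finset ι) (f : ι → ℕ) (M : ℕ)
    (hf : ∀ x ∈ s, f x ≤ M) :
    ∑ t ∈ Finset.range M, (s.filter fun x ↦ t < f x).card = ∑ x ∈ s, f x := by
  simp_rw [Finset.card_filter]
  rw [Finset.sum_comm]
  refine Finset.sum_congr rfl fun x hx ↦ ?_
  rw [← Finset.card_filter]
  have : (Finset.range M).filter (fun t ↦ t < f x) = Finset.range (f x) := by
    ext t
    have := hf x hx
    simp only [Finset.mem_filter, Finset.mem_range]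
    omega
  rw [this, Finset.card_range]

/-- In a tripartite graph on `U`, `V`, `W` in which degrees decrease as in a commutative graph, two
weighted Hall conditions for `V`, with reciprocal weights, force the second one to be tight. -/
lemma card_neighbors_eq_of_hall {ι : Type*} [DecidableEq ι] (U V W : Finset ι)
    (r s : ι → ι → Prop) [DecidableRel r] [DecidableRel s] (C : ℝ)
    (hU : ∀ T ⊆ V, (T.card : ℝ) ≤ C * (U.filter fun u ↦ ∃ v ∈ T, r u v).card)
    (hW : ∀ T ⊆ V, C * (T.card : ℝ) ≤ (W.filter fun w ↦ ∃ v ∈ T, s v w).card)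
    (hr : ∀ u ∈ U, ∀ v ∈ V, r u v →
      (W.filter fun w ↦ s v w).card ≤ (V.filter fun v' ↦ r u v').card)
    (hs : ∀ v ∈ V, ∀ w ∈ W, s v w →
      (U.filter fun u ↦ r u v).card ≤ (V.filter fun v' ↦ s v' w).card) :
    ((W.filter fun w ↦ ∃ v ∈ V, s v w).card : ℝ) = C * V.card := by
  have hC : 0 ≤ C ∨ V = ∅ := by
    by_contra! h
    have h1 := hU V subset_rfl
    have h2 : (0 : ℝ) < V.card := by exact_mod_cast h.2.card_pos
    nlinarith [(Nat.cast_nonneg (U.filter fun u ↦ ∃ v ∈ V, r u v).card : (0 : ℝ) ≤ _)]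
  obtain hC | rfl := hC
  swap
  · simp
  set M := U.card + V.card + W.card + 1 with hM
  set rout : ι → ℕ := fun u ↦ (V.filter fun v ↦ r u v).card with hrout
  set sout : ι → ℕ := fun v ↦ (W.filter fun w ↦ s v w).card with hsout
  set rin : ι → ℕ := fun v ↦ (U.filter fun u ↦ r u v).card with hrin
  set sin : ι → ℕ := fun w ↦ (V.filter fun v ↦ s v w).card with hsin
  have e1 : ∑ u ∈ U, rout u = ∑ v ∈ V, rin v :=
    Finset.sum_card_bipartiteAbove_eq_sum_card_bipartiteBelow r
  have e2 : ∑ v ∈ V, sout v = ∑ w ∈ W, sin w :=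
    Finset.sum_card_bipartiteAbove_eq_sum_card_bipartiteBelow s
  have bV (p : ι → Prop) [DecidablePred p] : (V.filter p).card ≤ M :=
    (Finset.card_filter_le _ _).trans (by omega)
  have bU (p : ι → Prop) [DecidablePred p] : (U.filter p).card ≤ M :=
    (Finset.card_filter_le _ _).trans (by omega)
  have bW (p : ι → Prop) [DecidablePred p] : (W.filter p).card ≤ M :=
    (Finset.card_filter_le _ _).trans (by omega)
  rw [← sum_card_filter_lt U rout M fun _ _ ↦ bV _,
    ← sum_card_filter_lt V rin M fun _ _ ↦ bU _] at e1
  rw [← sum_card_filter_lt V sout M fun _ _ ↦ bW _,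
    ← sum_card_filter_lt W sin M fun _ _ ↦ bV _] at e2
  have l1 (t : ℕ) : ((V.filter fun v ↦ t < sout v).card : ℝ) ≤
      C * (U.filter fun u ↦ t < rout u).card := by
    refine (hU _ (Finset.filter_subset _ _)).trans ?_
    gcongr with u hu
    rintro ⟨v, hv, huv⟩
    rw [Finset.mem_filter] at hv
    exact hv.2.trans_le (hr u hu v hv.1 huv)
  have l2 (t : ℕ) : C * ((V.filter fun v ↦ t < rin v).card : ℝ) ≤
      (W.filter fun w ↦ t < sin w).card := by
    refine (hW _ (Finset.filter_subset _ _)).trans ?_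
    gcongr with w hw
    rintro ⟨v, hv, hvw⟩
    rw [Finset.mem_filter] at hv
    exact hv.2.trans_le (hs v hv.1 w hw hvw)
  have key : ∑ t ∈ Finset.range M, C * ((V.filter fun v ↦ t < rin v).card : ℝ) =
      ∑ t ∈ Finset.range M, ((W.filter fun w ↦ t < sin w).card : ℝ) := by
    refine le_antisymm (Finset.sum_le_sum fun t _ ↦ l2 t) ?_
    have := Finset.sum_le_sum fun t (_ : t ∈ Finset.range M) ↦ l1 t
    rw [← Finset.mul_sum] at this ⊢
    rw [← Nat.cast_sum, ← Nat.cast_sum] at this ⊢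
    rwa [e1, e2] at this
  have h0 := (Finset.sum_eq_sum_iff_of_le fun t _ ↦ l2 t).1 key 0
    (Finset.mem_range.2 (by omega))
  have hV : (V.filter fun v ↦ 0 < rin v) = V := by
    refine Finset.filter_true_of_mem fun v hv ↦ ?_
    have := hU {v} (by simpa using hv)
    by_contra h
    have h' : (U.filter fun u ↦ r u v).card = 0 := by simpa [hrin] using h
    simp only [Finset.mem_singleton, exists_eq_left, h'] at this
    norm_num at this
  rw [hV] at h0
  rw [h0]
  congr 2
  ext w
  simp [hsin, Finset.card_pos, Finset.filter_nonempty_iff]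

section LayeredGraph

/-- `Q` is a subset of the layers of `V` strictly below `h`. -/
def IsSourceSide {G : Type*} (V : ℕ → Finset G) (h : ℕ) (Q : ℕ → Finset G) : Prop :=
  (∀ i, Q i ⊆ V i) ∧ ∀ i, h ≤ i → Q i = ∅

lemma finite_isSourceSide {G : Type*} (V : ℕ → Finset G) (h : ℕ) :
    {Q | IsSourceSide V h Q}.Finite := by
  refine Set.Finite.of_finite_image (f := fun Q (i : Fin h) ↦ Q i) ?_ ?_
  · refine (Fintype.piFinset fun i : Fin h ↦ (V i).powerset).finite_toSet.subset ?_
    rintro _ ⟨Q, hQ, rfl⟩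
    simpa using fun i : Fin h ↦ hQ.1 i
  · intro Q hQ Q' hQ' hQQ'
    funext i
    obtain hi | hi := lt_or_ge i h
    · exact congrFun hQQ' ⟨i, hi⟩
    · rw [hQ.2 i hi, hQ'.2 i hi]

lemma IsSourceSide.update {G : Type*} {V : ℕ → Finset G} {h : ℕ} {Q : ℕ → Finset G}
    (hQ : IsSourceSide V h Q) {m : ℕ} (hm : m < h) {R : Finset G} (hR : R ⊆ V m) :
    IsSourceSide V h (Function.update Q m R) := by
  refine ⟨fun i ↦ ?_, fun i hi ↦ ?_⟩
  · obtain rfl | hi := eq_or_ne i m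
    · simpa using hR
    · simpa [hi] using hQ.1 i
  · rw [Function.update_of_ne (by omega), hQ.2 i hi]

variable {G : Type*} [AddCommGroup G] [DecidableEq G]

/-- The vertices of layer `i` of the layered graph `V` with edges `v ⟶ v + b` that are joined to
the part `Q` of the previous layer; all vertices when `i = 0`. -/
def cutFrontier (V : ℕ → Finset G) (B : Finset G) (Q : ℕ → Finset G) : ℕ → Finset G
  | 0 => V 0
  | i + 1 => (Q i + B) ∩ V (i + 1)

/-- The weight of the vertex cut separating `Q` from its complement, where vertices in layer `i`
have weight `C⁻ⁱ`. -/
noncomputable def cutWeight (V : ℕ → Finset G) (B : Finset G) (C : ℝ) (h : ℕ)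
    (Q : ℕ → Finset G) : ℝ :=
  ∑ i ∈ Finset.range (h + 1), (C ^ i)⁻¹ * (cutFrontier V B Q i \ Q i).card

/-- There is a largest source side among those giving a cut of minimal weight. -/
lemma exists_optimal_cut (V : ℕ → Finset G) (B : Finset G) (C : ℝ) (h : ℕ) :
    ∃ Q, IsSourceSide V h Q ∧ ∀ Q', IsSourceSide V h Q' →
      cutWeight V B C h Q ≤ cutWeight V B C h Q' ∧
      (cutWeight V B C h Q' ≤ cutWeight V B C h Q →
        ∑ i ∈ Finset.range h, (Q' i).card ≤ ∑ i ∈ Finset.range h, (Q i).card) := by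
  have hne : {Q | IsSourceSide V h Q}.Nonempty := ⟨fun _ ↦ ∅, by simp, by simp⟩
  obtain ⟨Q₀, hQ₀, hmin⟩ :=
    Set.exists_min_image _ (cutWeight V B C h) (finite_isSourceSide V h) hne
  obtain ⟨Q, ⟨hQ, hQQ₀⟩, hmax⟩ := Set.exists_max_image
    {Q | IsSourceSide V h Q ∧ cutWeight V B C h Q ≤ cutWeight V B C h Q₀}
    (fun Q ↦ ∑ i ∈ Finset.range h, (Q i).card)
    ((finite_isSourceSide V h).subset fun Q hQ ↦ hQ.1) ⟨Q₀, hQ₀, le_rfl⟩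
  exact ⟨Q, hQ, fun Q' hQ' ↦ ⟨hQQ₀.trans (hmin Q' hQ'), fun hle ↦ hmax Q' ⟨hQ', hle.trans hQQ₀⟩⟩⟩

lemma cutFrontier_update_self (V : ℕ → Finset G) (B : Finset G) (Q : ℕ → Finset G) (m : ℕ)
    (R : Finset G) : cutFrontier V B (Function.update Q m R) m = cutFrontier V B Q m := by
  cases m <;> simp [cutFrontier]

lemma cutWeight_update_sub (V : ℕ → Finset G) (B : Finset G) (C : ℝ) {h : ℕ}
    (Q : ℕ → Finset G) {m : ℕ} (hm : m < h) (R : Finset G) :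
    cutWeight V B C h (Function.update Q m R) - cutWeight V B C h Q =
      (C ^ m)⁻¹ * ((cutFrontier V B Q m \ R).card - (cutFrontier V B Q m \ Q m).card) +
      (C ^ (m + 1))⁻¹ * ((((R + B) ∩ V (m + 1)) \ Q (m + 1)).card -
        (((Q m + B) ∩ V (m + 1)) \ Q (m + 1)).card) := by
  rw [cutWeight, cutWeight, ← Finset.sum_sub_distrib,
    ← Finset.sum_subset (s₁ := {m, m + 1}), Finset.sum_pair (by omega), cutFrontier_update_self]
  · simp only [Function.update_self, cutFrontier, ne_eq, Nat.add_eq_left, one_ne_zero,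
      not_false_eq_true, Function.update_of_ne]
    ring
  · intro i
    simp only [Finset.mem_insert, Finset.mem_singleton, Finset.mem_range]
    omega
  · intro i _ hi
    simp only [Finset.mem_insert, Finset.mem_singleton, not_or] at hi
    rw [Function.update_of_ne hi.1]
    cases i with
    | zero => simp [cutFrontier]
    | succ i =>
      have : i ≠ m := by omega
      simp [cutFrontier, this]

/-- In a commutative layered graph, the part of a minimal-weight cut in an intermediate layer can be
pushed to the next layer without increasing the weight. -/
lemma cutWeight_update_union_le {V : ℕ → Finset G} {B : Finset G} {C : ℝ} (hC : 0 < C) {h : ℕ}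
    (hcomm : ∀ i u b c, b ∈ B → c ∈ B → u ∈ V i → u + b + c ∈ V (i + 2) → u + c ∈ V (i + 1))
    {Q : ℕ → Finset G} (hQ : IsSourceSide V h Q)
    (hmin : ∀ Q', IsSourceSide V h Q' → cutWeight V B C h Q ≤ cutWeight V B C h Q')
    {k : ℕ} (hk : k + 1 < h) :
    cutWeight V B C h (Function.update Q (k + 1) (Q (k + 1) ∪ cutFrontier V B Q (k + 1))) ≤
      cutWeight V B C h Q := by
  set S := cutFrontier V B Q (k + 1) \ Q (k + 1) with hS
  set W := V (k + 2) \ ((Q (k + 1) + B) ∪ Q (k + 2)) with hW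
  have memS {x : G} : x ∈ S ↔ (x ∈ Q k + B ∧ x ∈ V (k + 1)) ∧ x ∉ Q (k + 1) := by
    simp [hS, cutFrontier]
  have hSV {T : Finset G} (hT : T ⊆ S) : T ⊆ V (k + 1) := fun x hx ↦ (memS.1 (hT hx)).1.2
  have hpow : (C ^ (k + 1))⁻¹ = C⁻¹ * (C ^ k)⁻¹ := by rw [pow_succ, mul_inv, mul_comm]
  have hpow' : (C ^ (k + 1 + 1))⁻¹ = C⁻¹ * (C ^ (k + 1))⁻¹ := by
    rw [pow_succ _ (k + 1), mul_inv, mul_comm]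
  -- adding `T ⊆ S` to the source side
  have hadd (T : Finset G) (hT : T ⊆ S) :
      cutWeight V B C h (Function.update Q (k + 1) (Q (k + 1) ∪ T)) - cutWeight V B C h Q ≤
        (C ^ (k + 2))⁻¹ * ((W.filter fun w ↦ ∃ v ∈ T, w - v ∈ B).card - C * T.card) := by
    rw [cutWeight_update_sub V B C Q hk]
    have h1 : ((cutFrontier V B Q (k + 1) \ (Q (k + 1) ∪ T)).card : ℝ) - S.card = - T.card := by
      rw [← Finset.sup_eq_union, ← sdiff_sdiff_left, ← hS, Finset.cast_card_sdiff hT]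
      ring
    have h2 : ((((Q (k + 1) ∪ T + B) ∩ V (k + 1 + 1)) \ Q (k + 1 + 1)).card : ℝ) ≤
        (((Q (k + 1) + B) ∩ V (k + 1 + 1)) \ Q (k + 1 + 1)).card +
          (W.filter fun w ↦ ∃ v ∈ T, w - v ∈ B).card := by
      norm_cast
      refine (Finset.card_le_card ?_).trans (Finset.card_union_le _ _)
      intro w
      simp only [hW, Finset.union_add, Finset.mem_sdiff, Finset.mem_inter, Finset.mem_union,
        Finset.mem_filter]
      rintro ⟨⟨h1 | h1, h2⟩, h3⟩
      · tauto
      · by_cases h4 : w ∈ Q (k + 1) + B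
        · tauto
        · obtain ⟨v, hv, b, hb, rfl⟩ := Finset.mem_add.1 h1
          exact Or.inr ⟨⟨h2, by tauto⟩, v, hv, by simpa using hb⟩
    rw [h1, hpow']
    have h3 : 0 < (C ^ (k + 1))⁻¹ := by positivity
    have h4 : 0 < C⁻¹ * (C ^ (k + 1))⁻¹ := by positivity
    have h5 : (C ^ (k + 1))⁻¹ * -(T.card : ℝ) = C⁻¹ * (C ^ (k + 1))⁻¹ * -(C * T.card) := by
      field_simp
    rw [h5, ← mul_add]
    exact mul_le_mul_of_nonneg_left (by linarith) h4.le
  have hforward (T : Finset G) (hT : T ⊆ S) :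
      C * (T.card : ℝ) ≤ (W.filter fun w ↦ ∃ v ∈ T, w - v ∈ B).card := by
    have h1 := hadd T hT
    have h2 := hmin _ (hQ.update hk (Finset.union_subset (hQ.1 _) (hSV hT)))
    have h3 : 0 < (C ^ (k + 2))⁻¹ := by positivity
    have := (mul_nonneg_iff_of_pos_left h3).1 ((sub_nonneg.2 h2).trans h1)
    linarith
  have hbackward (T : Finset G) (hT : T ⊆ S) :
      (T.card : ℝ) ≤ C * ((Q k).filter fun u ↦ ∃ v ∈ T, v - u ∈ B).card := by
    set D := (Q k).filter fun u ↦ ∃ v ∈ T, v - u ∈ B with hD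
    have h1 := hmin _ (hQ.update (by omega : k < h) (Finset.sdiff_subset.trans (hQ.1 k) :
      Q k \ D ⊆ V k))
    have h2 := cutWeight_update_sub V B C Q (by omega : k < h) (Q k \ D)
    have h3 : ((cutFrontier V B Q k \ (Q k \ D)).card : ℝ) ≤
        (cutFrontier V B Q k \ Q k).card + D.card := by
      norm_cast
      refine (Finset.card_le_card fun x ↦ ?_).trans (Finset.card_union_le _ _)
      simp only [Finset.mem_sdiff, Finset.mem_union]
      tauto
    have h4 : ((((Q k \ D + B) ∩ V (k + 1)) \ Q (k + 1)).card : ℝ) + T.card ≤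
        (((Q k + B) ∩ V (k + 1)) \ Q (k + 1)).card := by
      norm_cast
      rw [← Finset.card_union_of_disjoint]
      · refine Finset.card_le_card (Finset.union_subset ?_ fun x hx ↦ ?_)
        · gcongr
          exact Finset.sdiff_subset
        · simpa [and_assoc] using memS.1 (hT hx)
      · rw [Finset.disjoint_left]
        intro x hx hxT
        simp only [Finset.mem_sdiff, Finset.mem_inter, Finset.mem_add] at hx
        obtain ⟨⟨⟨u, ⟨hu, huD⟩, b, hb, rfl⟩, -⟩, -⟩ := hx
        exact huD (Finset.mem_filter.2 ⟨hu, _, hxT, by simpa using hb⟩)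
    rw [hpow] at h2
    have h5 : 0 < (C ^ k)⁻¹ := by positivity
    have h6 : 0 < C⁻¹ * (C ^ k)⁻¹ := by positivity
    have h7 : 0 ≤ (C ^ k)⁻¹ * (D.card : ℝ) + C⁻¹ * (C ^ k)⁻¹ * -(T.card : ℝ) := by
      refine (sub_nonneg.2 h1).trans (h2.le.trans (add_le_add ?_ ?_))
      · exact mul_le_mul_of_nonneg_left (by linarith) h5.le
      · exact mul_le_mul_of_nonneg_left (by linarith) h6.le
    have h8 : (C ^ k)⁻¹ * (D.card : ℝ) + C⁻¹ * (C ^ k)⁻¹ * -(T.card : ℝ) =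
        C⁻¹ * (C ^ k)⁻¹ * (C * D.card - T.card) := by
      field_simp
      ring
    rw [h8] at h7
    linarith [(mul_nonneg_iff_of_pos_left h6).1 h7]
  -- the missing corner of a square on `Q k`, `S`, `W` lies in `S`
  have hcorner {u v w : G} (hu : u ∈ Q k) (hv : v - u ∈ B) (hw : w ∈ W) (hvw : w - v ∈ B) :
      u + (w - v) ∈ S := by
    simp only [hW, Finset.mem_sdiff, Finset.mem_union, not_or] at hw
    refine memS.2 ⟨⟨Finset.add_mem_add hu hvw, ?_⟩, fun hmem ↦ hw.2.1 ?_⟩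
    · refine hcomm k u (v - u) (w - v) hv hvw (hQ.1 k hu) ?_
      convert hw.1 using 1
      abel
    · convert Finset.add_mem_add hmem hv using 1
      abel
  have hcard := card_neighbors_eq_of_hall (Q k) S W (fun u v ↦ v - u ∈ B) (fun v w ↦ w - v ∈ B)
    C hbackward hforward
    (fun u hu v _ huv ↦ Finset.card_le_card_of_injOn (fun w ↦ u + (w - v))
      (fun w hw ↦ by
        have hw := Finset.mem_filter.1 hw
        refine Finset.mem_filter.2 ⟨hcorner hu huv hw.1 hw.2, by simpa using hw.2⟩)
      (fun w _ w' _ hww' ↦ by simpa using hww'))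
    (fun v _ w hw hvw ↦ Finset.card_le_card_of_injOn (fun u ↦ u + (w - v))
      (fun u hu ↦ by
        have hu := Finset.mem_filter.1 hu
        refine Finset.mem_filter.2 ⟨hcorner hu.1 hu.2 hw hvw, ?_⟩
        have h1 : w - (u + (w - v)) = v - u := by abel
        simpa only [h1] using hu.2)
      (fun u _ u' _ huu' ↦ by simpa using huu'))
  have := hadd S subset_rfl
  rw [hcard, sub_self, mul_zero, hS, Finset.union_sdiff_self_eq_union] at this
  linarith

/-- **Plünnecke's inequality** for commutative layered graphs in an abelian group: if the
magnification ratio at layer `j` is attained by the whole bottom layer, then the growth of the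
later layers is controlled. -/
theorem card_layer_le_of_minimal_growth {V : ℕ → Finset G} {B : Finset G} {C : ℝ} (hC : 0 < C)
    {j h : ℕ} (hjh : j < h)
    (hcomm : ∀ i u b c, b ∈ B → c ∈ B → u ∈ V i → u + b + c ∈ V (i + 2) → u + c ∈ V (i + 1))
    (hgen : ∀ i, V (i + 1) ⊆ V i + B)
    (hj : 1 ≤ j) (hVj : ((V j).card : ℝ) ≤ C ^ j * (V 0).card)
    (hmin : ∀ Q : ℕ → Finset G, (∀ i, Q i ⊆ V i) →
      (∀ i < j, (Q i + B) ∩ V (i + 1) ⊆ Q (i + 1)) → C ^ j * ((Q 0).card : ℝ) ≤ (Q j).card) :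
    ((V h).card : ℝ) ≤ C ^ h * (V 0).card := by
  obtain ⟨Q, hQ, hopt⟩ := exists_optimal_cut V B C h
  have hclosed : ∀ k, k + 1 < h → (Q k + B) ∩ V (k + 1) ⊆ Q (k + 1) := by
    intro k hk
    have hle := cutWeight_update_union_le hC hcomm hQ (fun Q' hQ' ↦ (hopt Q' hQ').1) hk
    have hsum := (hopt _ (hQ.update hk (Finset.union_subset (hQ.1 _)
      Finset.inter_subset_right))).2 hle
    by_contra hsub
    refine hsum.not_gt (Finset.sum_lt_sum (fun i _ ↦ ?_) ⟨k + 1, Finset.mem_range.2 hk, ?_⟩)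
    · obtain rfl | hi := eq_or_ne i (k + 1)
      · simpa using Finset.card_le_card Finset.subset_union_left
      · simp [hi]
    · rw [Function.update_self]
      refine Finset.card_lt_card (Finset.ssubset_iff_subset_ne.2
        ⟨Finset.subset_union_left, fun heq ↦ hsub ?_⟩)
      exact Finset.union_eq_left.1 heq.symm
  -- filling up the layers below `j` does not increase the weight
  set Q' : ℕ → Finset G := fun i ↦ if i < j then V i else Q i with hQ'
  have hQ's : IsSourceSide V h Q' := by
    refine ⟨fun i ↦ ?_, fun i hi ↦ ?_⟩
    · by_cases hi : i < j
      · simp [hQ', hi]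
      · simpa [hQ', hi] using hQ.1 i
    · have : ¬ i < j := by omega
      simpa [hQ', this] using hQ.2 i hi
  have hweight : cutWeight V B C h Q' - cutWeight V B C h Q ≤
      (C ^ j)⁻¹ * (V j \ Q j).card - (V 0 \ Q 0).card := by
    rw [cutWeight, cutWeight, ← Finset.sum_sub_distrib,
      ← Finset.sum_subset (s₁ := {0, j}), Finset.sum_pair (by omega)]
    · obtain ⟨i, rfl⟩ := Nat.exists_eq_add_of_le' hj
      have h1 : ((((V i + B) ∩ V (i + 1)) \ Q (i + 1)).card : ℝ) ≤ (V (i + 1) \ Q (i + 1)).card := by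
        gcongr
        exact Finset.inter_subset_right
      have h2 : 0 < (C ^ (i + 1))⁻¹ := by positivity
      have h3 := mul_le_mul_of_nonneg_left h1 h2.le
      have h4 := hclosed i hjh
      simp only [cutFrontier, hQ', lt_self_iff_false, if_false, Nat.lt_succ_self, if_true,
        Finset.sdiff_eq_empty_iff_subset.2 h4, Nat.succ_pos]
      simp
      linarith
    · intro i
      simp only [Finset.mem_insert, Finset.mem_singleton, Finset.mem_range]
      omega
    · intro i hi hij
      simp only [Finset.mem_insert, Finset.mem_singleton, Finset.mem_range, not_or] at hi hij
      obtain ⟨i, rfl⟩ := Nat.exists_eq_succ_of_ne_zero hij.1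
      simp only [Nat.succ_eq_add_one] at *
      by_cases hlt : i + 1 < j
      · have h4 := hclosed i (by omega)
        have h5 : i < j := by omega
        simp [cutFrontier, hQ', hlt, h5, Finset.sdiff_eq_empty_iff_subset.2 h4]
      · have h5 : ¬ i < j := by omega
        simp [cutFrontier, hQ', hlt, h5]
  have hle : cutWeight V B C h Q' ≤ cutWeight V B C h Q := by
    have h1 := hmin Q hQ.1 fun i hi ↦ hclosed i (by omega)
    have h2 : (C ^ j)⁻¹ * ((V j \ Q j).card : ℝ) ≤ (V 0 \ Q 0).card := by
      rw [inv_mul_le_iff₀ (by positivity), Finset.cast_card_sdiff (hQ.1 _),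
        Finset.cast_card_sdiff (hQ.1 _)]
      linarith
    linarith
  have hQ0 : V 0 ⊆ Q 0 := by
    have hsum := (hopt Q' hQ's).2 hle
    by_contra hsub
    refine hsum.not_gt (Finset.sum_lt_sum (fun i _ ↦ ?_) ⟨0, Finset.mem_range.2 (by omega), ?_⟩)
    · by_cases hi : i < j
      · simpa [hQ', hi] using Finset.card_le_card (hQ.1 i)
      · simp [hQ', hi]
    · have : 0 < j := by omega
      simp only [hQ', this, if_true]
      exact Finset.card_lt_card ⟨hQ.1 0, hsub⟩
  have hfull : ∀ i < h, V i ⊆ Q i := by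
    intro i
    induction i with
    | zero => exact fun _ ↦ hQ0
    | succ i ih =>
      intro hi
      refine Finset.Subset.trans (Finset.subset_inter ?_ subset_rfl) (hclosed i hi)
      exact (hgen i).trans (Finset.add_subset_add_right (ih (by omega)))
  have hlow : (C ^ h)⁻¹ * ((V h).card : ℝ) ≤ cutWeight V B C h Q := by
    obtain ⟨n, rfl⟩ := Nat.exists_eq_add_of_lt hjh
    refine le_trans (le_of_eq ?_) (Finset.single_le_sum (f := fun i ↦ (C ^ i)⁻¹ *
      ((cutFrontier V B Q i \ Q i).card : ℝ)) (fun i _ ↦ by positivity)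
      (Finset.self_mem_range_succ _))
    have h1 : cutFrontier V B Q (j + n + 1) = V (j + n + 1) :=
      Finset.inter_eq_right.2
        ((hgen _).trans (Finset.add_subset_add_right (hfull _ (by omega))))
    simp only [h1, hQ.2 _ le_rfl, Finset.sdiff_empty]
  have hup : cutWeight V B C h (fun _ ↦ ∅) = (V 0).card := by
    rw [cutWeight, Finset.sum_range_succ']
    simp [cutFrontier]
  have := hlow.trans ((hopt (fun _ ↦ ∅) ⟨by simp, by simp⟩).1.trans hup.le)
  rwa [inv_mul_le_iff₀ (by positivity)] at this

end LayeredGraph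

section RestrictedSumset

variable {G : Type*} [AddCommGroup G] [DecidableEq G]

/-- The `i`-th layer of the restricted addition graph. -/
def restrictedSumset (X B J : Finset G) (i : ℕ) : Finset G :=
  (X + iterSum B i) \ (J + iterSum B i)

lemma restrictedSumset_succ (X B J : Finset G) (i : ℕ) :
    restrictedSumset X B J (i + 1) =
      (restrictedSumset X B J i + B) \ (J + iterSum B (i + 1)) := by
  ext x
  simp only [restrictedSumset, Finset.mem_sdiff, iterSum, ← add_assoc]
  refine and_congr_left fun hx ↦ ?_
  constructor
  · intro h
    obtain ⟨y, hy, b, hb, rfl⟩ := Finset.mem_add.1 h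
    exact Finset.add_mem_add (Finset.mem_sdiff.2
      ⟨hy, fun hyJ ↦ hx (Finset.add_mem_add hyJ hb)⟩) hb
  · exact fun h ↦ Finset.add_subset_add_right Finset.sdiff_subset h

lemma restrictedSumset_mono_left {X Z : Finset G} (B J : Finset G) (hZ : Z ⊆ X) (i : ℕ) :
    restrictedSumset Z B J i ⊆ restrictedSumset X B J i :=
  Finset.sdiff_subset_sdiff (Finset.add_subset_add_right hZ) subset_rfl

lemma restrictedSumset_zero {X J : Finset G} (B : Finset G) (hJX : J ∩ X = ∅) :
    restrictedSumset X B J 0 = X := by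
  have : Disjoint X J := by rw [Finset.disjoint_iff_inter_eq_empty, Finset.inter_comm, hJX]
  rw [restrictedSumset, iterSum, Finset.singleton_zero, add_zero, add_zero, this.sdiff_eq_left]

lemma restrictedSumset_comm (X B J : Finset G) (i : ℕ) (u b c : G) (hb : b ∈ B) (hc : c ∈ B)
    (hu : u ∈ restrictedSumset X B J i) (h : u + b + c ∈ restrictedSumset X B J (i + 2)) :
    u + c ∈ restrictedSumset X B J (i + 1) := by
  rw [restrictedSumset_succ, Finset.mem_sdiff]
  refine ⟨Finset.add_mem_add hu hc, fun hJ ↦ (Finset.mem_sdiff.1 h).2 ?_⟩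
  rw [show iterSum B (i + 2) = iterSum B (i + 1) + B from rfl, ← add_assoc,
    add_right_comm u b c]
  exact Finset.add_mem_add hJ hb

end RestrictedSumset

/-- Restricted sumset growth: if `|(X + jB) \ (J + jB)| = α^j |X|` and this ratio is
minimal among non-empty subsets of `X`, then `|(X + hB) \ (J + hB)| ≤ α^h |X|`. -/
theorem stmt_16 {G : Type*} [AddCommGroup G] [DecidableEq G]
    (j h : ℕ) (hj : 1 ≤ j) (hjh : j ≤ h)
    (X B J : Finset G) (hX : X.Nonempty) (hB : B.Nonempty)
    (hJX : J ∩ X = ∅) (α : ℝ) (hα : 0 ≤ α)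
    (heq : (((X + iterSum B j) \ (J + iterSum B j)).card : ℝ) = α ^ j * (X.card : ℝ))
    (hmin : ∀ Z ⊆ X, Z.Nonempty →
      ((X + iterSum B j) \ (J + iterSum B j)).card * Z.card ≤
        ((Z + iterSum B j) \ (J + iterSum B j)).card * X.card) :
    (((X + iterSum B h) \ (J + iterSum B h)).card : ℝ) ≤ α ^ h * (X.card : ℝ) := by
  obtain rfl | hlt := hjh.eq_or_lt
  · exact heq.le
  obtain rfl | hpos := hα.eq_or_lt
  · rw [zero_pow (by omega), zero_mul] at heq ⊢
    have hempty : ∀ n, restrictedSumset X B J (j + n) = ∅ := by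
      intro n
      induction n with
      | zero => exact Finset.card_eq_zero.1 (by exact_mod_cast heq)
      | succ n ih => simp [← add_assoc, restrictedSumset_succ, ih]
    have := hempty (h - j)
    rw [Nat.add_sub_cancel' hjh] at this
    exact_mod_cast (Finset.card_eq_zero.2 this).le
  have h0 : restrictedSumset X B J 0 = X := restrictedSumset_zero B hJX
  have hmain := card_layer_le_of_minimal_growth (V := restrictedSumset X B J) (B := B) hpos hlt
    (restrictedSumset_comm X B J)
    (fun i ↦ by rw [restrictedSumset_succ]; exact Finset.sdiff_subset) hj
    (by rw [h0]; exact heq.le) ?_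
  · rwa [h0] at hmain
  intro Q hQ hclosed
  have hQX : Q 0 ⊆ X := h0 ▸ hQ 0
  have hsub : ∀ i ≤ j, restrictedSumset (Q 0) B J i ⊆ Q i := by
    intro i
    induction i with
    | zero =>
      intro _
      rw [restrictedSumset_zero B (Finset.subset_empty.1
        (hJX ▸ Finset.inter_subset_inter_left hQX))]
    | succ i ih =>
      intro hi
      refine (Finset.subset_inter ?_ (restrictedSumset_mono_left B J hQX _)).trans
        (hclosed i hi)
      rw [restrictedSumset_succ]
      exact Finset.sdiff_subset.trans (Finset.add_subset_add_right (ih (by omega)))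
  obtain hQ0 | hQ0 := (Q 0).eq_empty_or_nonempty
  · simp [hQ0]
  have hXpos : (0 : ℝ) < X.card := by exact_mod_cast hX.card_pos
  have h1 : (((X + iterSum B j) \ (J + iterSum B j)).card : ℝ) * (Q 0).card ≤
      (restrictedSumset (Q 0) B J j).card * X.card := by exact_mod_cast hmin (Q 0) hQX hQ0
  have h2 : ((restrictedSumset (Q 0) B J j).card : ℝ) ≤ (Q j).card := by
    exact_mod_cast Finset.card_le_card (hsub j le_rfl)
  rw [heq] at h1
  refine le_trans (le_of_mul_le_mul_right ?_ hXpos) h2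
  linarith
end

section
/- Let $j \ge 1$ be an integer and let $X$, $B$, $J$ be finite sets in a commutative group with $X$, $B$ non-empty and $J \cap X = \emptyset$. Let $\alpha \ge 0$ be a real with $|(X + jB) \setminus (J + jB)| = \alpha^j |X|$, and suppose that for every non-empty subset $Z \subseteq X$ one has $|(X + jB) \setminus (J + jB)| \cdot |Z| \le |(Z + jB) \setminus (J + jB)| \cdot |X|$. Then for every finite set $S$ in the group, $|(X + jB + S) \setminus (J + jB + S)| \le \alpha \cdot |(X + (j-1)B + S) \setminus (J + (j-1)B + S)|$. -/
open Pointwise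

section

open Finset

variable {G : Type*} [AddCommGroup G] [DecidableEq G]

theorem card_add_sdiff_add_of_subset {X Y J T : Finset G} (h : Y ⊆ X) :
    ((X + T) \ (J + T)).card =
      ((Y + T) \ (J + T)).card + ((X + T) \ (J ∪ Y + T)).card := by
  have hYX : Y + T ⊆ X + T := add_subset_add_right h
  rw [← card_union_of_disjoint]
  · congr 1
    ext g
    have := @hYX g
    simp only [union_add, mem_sdiff, mem_union]
    tauto
  · rw [disjoint_left]
    intro g
    simp only [union_add, mem_sdiff, mem_union]
    tauto

theorem card_singleton_add_sdiff {X J T : Finset G} (s : G) :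
    ((X + {s} + T) \ (J + T)).card = ((X + T) \ (J + {-s} + T)).card := by
  have h₁ : X + {s} + T = {s} + (X + T) := by abel
  have h₂ : J + T = {s} + (J + {-s} + T) := by
    have h : ({s} : Finset G) + {-s} = 0 := by simp [singleton_zero]
    calc J + T = 0 + (J + T) := by simp
      _ = _ := by rw [← h]; abel
  rw [h₁, h₂, singleton_add, singleton_add, ← vadd_finset_sdiff, card_vadd_finset]

/-- A growth bound that holds relative to every set containing `J` is preserved when a
finite set `S` is added. -/
theorem card_add_sdiff_add_le_mul {X J T U : Finset G} {α : ℝ}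
    (h : ∀ K, J ⊆ K → (((X + T) \ (K + T)).card : ℝ) ≤ α * ((X + U) \ (K + U)).card)
    (S : Finset G) : ∀ K, J + S ⊆ K →
      (((X + S + T) \ (K + T)).card : ℝ) ≤ α * ((X + S + U) \ (K + U)).card := by
  induction S using Finset.induction_on with
  | empty => intro K _; simp
  | insert s S _ ih =>
    intro K hK
    have hsub : X + S ⊆ X + insert s S := add_subset_add_left (subset_insert s S)
    have key (R : Finset G) : ((X + insert s S + R) \ (K + R)).card =
        ((X + S + R) \ (K + R)).card +
          ((X + R) \ (K ∪ (X + S) + {-s} + R)).card := by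
      rw [card_add_sdiff_add_of_subset hsub, ← card_singleton_add_sdiff]
      congr 2
      ext g
      simp only [insert_eq, union_add, add_union, mem_sdiff, mem_union]
      tauto
    have h₁ := ih K ((add_subset_add_left (subset_insert s S)).trans hK)
    have h₂ := h (K ∪ (X + S) + {-s}) (by
      intro g hg
      have hgs : g + s ∈ K := hK (add_mem_add hg (mem_insert_self s S))
      simpa using add_mem_add (mem_union_left (X + S) hgs) (mem_singleton_self (-s)))
    rw [key, key]
    push_cast
    linarith

theorem exists_min_growth {X J T : Finset G} (hX : X.Nonempty) :
    ∃ Y ⊆ X, Y.Nonempty ∧ ∃ r : ℝ, 0 ≤ r ∧ (((Y + T) \ (J + T)).card : ℝ) = r * Y.card ∧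
      ∀ Z ⊆ X, r * Z.card ≤ ((Z + T) \ (J + T)).card := by
  obtain ⟨Y, hY, hmin⟩ := exists_min_image (X.powerset.filter Finset.Nonempty)
    (fun Z => (((Z + T) \ (J + T)).card : ℝ) / Z.card)
    ⟨X, by simp [hX]⟩
  simp only [mem_filter, mem_powerset] at hY hmin
  have hpos : (0 : ℝ) < Y.card := by exact_mod_cast hY.2.card_pos
  refine ⟨Y, hY.1, hY.2, _, by positivity, (div_mul_cancel₀ _ hpos.ne').symm, fun Z hZ => ?_⟩
  rcases Z.eq_empty_or_nonempty with rfl | hne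
  · simp
  · have hZpos : (0 : ℝ) < Z.card := by exact_mod_cast hne.card_pos
    exact (le_div_iff₀ hZpos).1 (hmin Z ⟨hZ, hne⟩)

theorem card_add_sdiff_add_le_of_min {X J K T : Finset G} {r : ℝ}
    (hle : (((X + T) \ (J + T)).card : ℝ) ≤ r * X.card)
    (hmin : ∀ Z ⊆ X, r * Z.card ≤ ((Z + T) \ (J + T)).card) (hJK : J ⊆ K) :
    (((X + T) \ (K + T)).card : ℝ) ≤ r * (X \ K).card := by
  have h₁ := hmin (X ∩ K) inter_subset_left
  have h₂ := card_add_sdiff_add_of_subset (J := J) (T := T) (inter_subset_left : X ∩ K ⊆ X)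
  have h₃ : ((X + T) \ (K + T)).card ≤ ((X + T) \ (J ∪ X ∩ K + T)).card :=
    card_le_card (sdiff_subset_sdiff le_rfl
      (add_subset_add_right (union_subset hJK inter_subset_right)))
  have h₄ : ((X \ K).card : ℝ) + (X ∩ K).card = X.card := by
    exact_mod_cast card_sdiff_add_card_inter X K
  have h₂' : (((X + T) \ (J + T)).card : ℝ) = ((X ∩ K + T) \ (J + T)).card +
      ((X + T) \ (J ∪ X ∩ K + T)).card := by exact_mod_cast h₂
  have h₃' : (((X + T) \ (K + T)).card : ℝ) ≤ ((X + T) \ (J ∪ X ∩ K + T)).card := by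
    exact_mod_cast h₃
  rw [← h₄, mul_add] at hle
  linarith

theorem card_sdiff_add_sdiff_add (X K T : Finset G) :
    ((X \ K + T) \ (K + T)).card = ((X + T) \ (K + T)).card := by
  congr 1
  rw [← union_sdiff_right (X \ K + T), ← union_add, sdiff_union_self_eq_union, union_add,
    union_sdiff_right]

theorem reiher_inequality (B : Finset G) (k : ℕ) : ∀ (X J : Finset G) (α : ℝ), 0 ≤ α →
    (((X + iterSum B (k + 1)) \ (J + iterSum B (k + 1))).card : ℝ) ≤ α ^ (k + 1) * X.card →
    (∀ Z ⊆ X, α ^ (k + 1) * Z.card ≤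
      ((Z + iterSum B (k + 1)) \ (J + iterSum B (k + 1))).card) →
    ∀ S : Finset G,
      (((X + iterSum B (k + 1) + S) \ (J + iterSum B (k + 1) + S)).card : ℝ) ≤
        α * ((X + iterSum B k + S) \ (J + iterSum B k + S)).card := by
  induction k with
  | zero =>
    intro X J α _ hle hmin S
    have h := card_add_sdiff_add_le_mul (X := X) (J := J) (T := iterSum B 1)
      (U := iterSum B 0) (α := α) (fun K hK => by
        simpa [iterSum, singleton_zero] using card_add_sdiff_add_le_of_min hle hmin hK) S (J + S) subset_rfl
    simpa only [add_right_comm _ S] using h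
  | succ k ih =>
    intro X J α hα hle hmin S
    have hrel (n : ℕ) : ∀ K, J ⊆ K → (X \ K).card = n →
        (((X + iterSum B (k + 2)) \ (K + iterSum B (k + 2))).card : ℝ) ≤
          α * ((X + iterSum B (k + 1)) \ (K + iterSum B (k + 1))).card := by
      induction n using Nat.strong_induction_on with
      | _ n ihn =>
        intro K hJK hn
        have htop := card_add_sdiff_add_le_of_min hle hmin hJK
        rcases (X \ K).eq_empty_or_nonempty with hempty | hne
        · rw [hempty, card_empty, Nat.cast_zero, mul_zero] at htop
          exact htop.trans (by positivity)
        obtain ⟨Y, hYX, hY, r, hr, hYr, hYmin⟩ :=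
          exists_min_growth (J := K) (T := iterSum B (k + 1)) hne
        rcases le_total (α ^ (k + 1)) r with hαr | hrα
        · have h := hYmin (X \ K) subset_rfl
          rw [card_sdiff_add_sdiff_add] at h
          calc _ ≤ α ^ (k + 2) * (X \ K).card := htop
            _ = α * (α ^ (k + 1) * (X \ K).card) := by ring
            _ ≤ α * (r * (X \ K).card) := by gcongr
            _ ≤ _ := by gcongr
        · obtain ⟨β, hβ, rfl⟩ : ∃ β : ℝ, 0 ≤ β ∧ β ^ (k + 1) = r :=
            ⟨r ^ ((k + 1 : ℕ) : ℝ)⁻¹, by positivity, Real.rpow_inv_natCast_pow hr (by omega)⟩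
          have hβα : β ≤ α := le_of_pow_le_pow_left₀ (by omega) hα hrα
          have hstep := ih Y K β hβ hYr.le (fun Z hZ => hYmin Z (hZ.trans hYX)) B
          have hshift (Z : Finset G) : Z + iterSum B k + B = Z + iterSum B (k + 1) :=
            add_assoc _ _ _
          have hshift' (Z : Finset G) : Z + iterSum B (k + 1) + B = Z + iterSum B (k + 2) :=
            add_assoc _ _ _
          simp only [hshift, hshift'] at hstep
          have hsub : Y ⊆ X := hYX.trans sdiff_subset
          have hlt : (X \ (K ∪ Y)).card < n := by
            rw [← hn]
            refine card_lt_card ⟨sdiff_subset_sdiff le_rfl subset_union_left, fun h => ?_⟩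
            obtain ⟨y, hy⟩ := hY
            exact (mem_sdiff.1 (h (hYX hy))).2 (mem_union_right K hy)
          have hrest := ihn _ hlt (K ∪ Y) (hJK.trans subset_union_left) rfl
          rw [card_add_sdiff_add_of_subset (T := iterSum B (k + 2)) hsub,
            card_add_sdiff_add_of_subset (T := iterSum B (k + 1)) hsub]
          have hmono := mul_le_mul_of_nonneg_right hβα
            (Nat.cast_nonneg (α := ℝ) ((Y + iterSum B (k + 1)) \ (K + iterSum B (k + 1))).card)
          push_cast
          linarith
    have h := card_add_sdiff_add_le_mul (fun K hK => hrel _ K hK rfl) S (J + S) subset_rfl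
    simpa only [add_right_comm _ S] using h

end

/-- Reiher's inequality: under the hypotheses of the restricted sumset growth corollary,
for every finite set `S` one has
`|(X + jB + S) \ (J + jB + S)| ≤ α |(X + (j-1)B + S) \ (J + (j-1)B + S)|`. -/
theorem stmt_17 {G : Type*} [AddCommGroup G] [DecidableEq G]
    (j : ℕ) (hj : 1 ≤ j)
    (X B J : Finset G) (hX : X.Nonempty) (hB : B.Nonempty)
    (hJX : J ∩ X = ∅) (α : ℝ) (hα : 0 ≤ α)
    (heq : (((X + iterSum B j) \ (J + iterSum B j)).card : ℝ) = α ^ j * (X.card : ℝ))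
    (hmin : ∀ Z ⊆ X, Z.Nonempty →
      ((X + iterSum B j) \ (J + iterSum B j)).card * Z.card ≤
        ((Z + iterSum B j) \ (J + iterSum B j)).card * X.card)
    (S : Finset G) :
    (((X + iterSum B j + S) \ (J + iterSum B j + S)).card : ℝ) ≤
      α * (((X + iterSum B (j - 1) + S) \ (J + iterSum B (j - 1) + S)).card : ℝ) := by
  obtain ⟨k, rfl⟩ : ∃ k, j = k + 1 := ⟨j - 1, by omega⟩
  refine reiher_inequality B k X J α hα heq.le (fun Z hZ => ?_) S
  rcases Z.eq_empty_or_nonempty with rfl | hne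
  · simp
  · have hpos : (0 : ℝ) < X.card := by exact_mod_cast hX.card_pos
    have h := hmin Z hZ hne
    rify at h
    rw [heq] at h
    refine le_of_mul_le_mul_right ?_ hpos
    linarith
end

section
/- Let $h$, $l$, $a$ be positive integers with $h$ dividing $a^{h-1}$. Then there exist a commutative group $G$ and finite sets $A$, $B$ in $G$ such that $|A| = a^h + a^{h-1}/h$, $|A + B| \le (h+1)\, l\, a^h$, and $|A + hB| \ge 1 + \bigl((la)^h - 1\bigr) \cdot a^{h-1}/h$. -/
open Pointwise

theorem sum_mem_iterSum {G ι : Type*} [AddCommGroup G] [DecidableEq G] (B : Finset G)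
    (s : Finset ι) (f : ι → G) (hf : ∀ i ∈ s, f i ∈ B) :
    ∑ i ∈ s, f i ∈ iterSum B s.card := by
  classical
  induction s using Finset.induction_on with
  | empty => simp [iterSum]
  | insert i s hi ih =>
    rw [Finset.sum_insert hi, Finset.card_insert_of_notMem hi, add_comm (f i)]
    exact Finset.add_mem_add (ih fun j hj => hf j (Finset.mem_insert_of_mem hj))
      (hf i (Finset.mem_insert_self i s))

/-- The union of the coordinate axes of `M ^ ι`. -/
def coordinateAxes (ι M : Type*) [Fintype ι] [DecidableEq ι] [Fintype M] [DecidableEq M] [Zero M] :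
    Finset (ι → M) :=
  Finset.univ.biUnion fun i => Finset.univ.image (Pi.single i)

section CoordinateAxes

variable {ι M : Type*} [Fintype ι] [DecidableEq ι] [Fintype M] [DecidableEq M]

theorem single_mem_coordinateAxes [Zero M] (i : ι) (c : M) :
    Pi.single i c ∈ coordinateAxes ι M := by
  simp only [coordinateAxes, Finset.mem_biUnion, Finset.mem_image, Finset.mem_univ, true_and]
  exact ⟨i, c, rfl⟩

theorem card_coordinateAxes_le [Zero M] :
    (coordinateAxes ι M).card ≤ Fintype.card ι * Fintype.card M :=
  Finset.card_biUnion_le_card_mul _ _ _ fun _ _ => Finset.card_image_le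

theorem card_piFinset_add_coordinateAxes_le [AddGroup M] (P : Finset M) :
    (Fintype.piFinset (fun _ : ι => P) + coordinateAxes ι M).card ≤
      Fintype.card ι * (Fintype.card M * P.card ^ (Fintype.card ι - 1)) := by
  have hsub : Fintype.piFinset (fun _ : ι => P) + coordinateAxes ι M ⊆
      Finset.univ.biUnion fun i =>
        Fintype.piFinset (Function.update (fun _ : ι => P) i Finset.univ) := by
    intro z hz
    obtain ⟨x, hx, y, hy, rfl⟩ := Finset.mem_add.1 hz
    simp only [coordinateAxes, Finset.mem_biUnion, Finset.mem_image, Finset.mem_univ,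
      true_and] at hy
    obtain ⟨i, c, rfl⟩ := hy
    refine Finset.mem_biUnion.2 ⟨i, Finset.mem_univ i, Fintype.mem_piFinset.2 fun j => ?_⟩
    by_cases hj : j = i
    · subst hj
      simp
    · simpa [hj] using Fintype.mem_piFinset.1 hx j
  refine (Finset.card_le_card hsub).trans
    (Finset.card_biUnion_le_card_mul _ _ _ fun i _ => le_of_eq ?_)
  rw [Fintype.card_piFinset, ← Finset.mul_prod_erase _ _ (Finset.mem_univ i)]
  congr 1
  · simp
  · rw [Finset.prod_congr rfl (g := fun _ => P.card)
      fun j hj => by simp [Finset.ne_of_mem_erase hj]]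
    simp

theorem mem_iterSum_coordinateAxes_product {H : Type*} [AddCommGroup M] [AddCommGroup H]
    [DecidableEq H] (x : ι → M) :
    (x, (0 : H)) ∈ iterSum (coordinateAxes ι M ×ˢ ({0} : Finset H)) (Fintype.card ι) := by
  have key := sum_mem_iterSum (coordinateAxes ι M ×ˢ ({0} : Finset H)) Finset.univ
    (fun i => (Pi.single i (x i), (0 : H)))
    fun i _ => by simp [single_mem_coordinateAxes]
  have hsum : ∑ i, ((Pi.single i (x i) : ι → M), (0 : H)) = (x, 0) := by
    ext1
    · rw [Prod.fst_sum]
      exact Finset.univ_sum_single x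
    · simp [Prod.snd_sum]
  rwa [hsum] at key

end CoordinateAxes

/-- Ruzsa-type lower bound construction: for positive integers `h`, `l`, `a` with
`h ∣ a^(h-1)` there are finite sets `A`, `B` in a commutative group with
`|A| = a^h + a^(h-1)/h`, `|A + B| ≤ (h+1) l a^h` and
`|A + hB| ≥ 1 + ((la)^h - 1) a^(h-1)/h`. -/
theorem stmt_18 (h l a : ℕ) (hh : 0 < h) (hl : 0 < l) (ha : 0 < a)
    (hdvd : h ∣ a ^ (h - 1)) :
    ∃ (G : Type) (_ : AddCommGroup G) (_ : DecidableEq G) (A B : Finset G),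
      A.card = a ^ h + a ^ (h - 1) / h ∧
      (A + B).card ≤ (h + 1) * l * a ^ h ∧
      1 + ((l * a) ^ h - 1) * (a ^ (h - 1) / h) ≤ (A + iterSum B h).card := by
  obtain ⟨N, hN⟩ := hdvd
  have hNpos : 0 < N := by
    rcases Nat.eq_zero_or_pos N with rfl | hpos
    · have := pow_pos ha (h - 1)
      omega
    · exact hpos
  have hdiv : a ^ (h - 1) / h = N := by rw [hN, Nat.mul_div_cancel_left N hh]
  have hpow : a ^ h = a * (h * N) := by
    rw [← hN, ← pow_succ', Nat.sub_add_cancel hh]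
  rw [hdiv]
  have hb : 0 < l * a := Nat.mul_pos hl ha
  have : NeZero (l * a) := ⟨hb.ne'⟩
  obtain ⟨P, -, hP⟩ := Finset.exists_subset_card_eq (s := (Finset.univ : Finset (ZMod (l * a))))
    (n := a) (by simpa [ZMod.card] using Nat.le_mul_of_pos_left a hl)
  set S : Finset (Fin h → ZMod (l * a)) := Fintype.piFinset fun _ => P
  set C := coordinateAxes (Fin h) (ZMod (l * a))
  set T : Finset (ZMod (N + 1)) := Finset.univ.erase 0
  have hS : S.card = a ^ h := by simp [S, hP]
  have hT : T.card = N := by simp [T, ZMod.card]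
  refine ⟨(Fin h → ZMod (l * a)) × ZMod (N + 1), inferInstance, inferInstance,
    S ×ˢ {0} ∪ {0} ×ˢ T, C ×ˢ {0}, ?_, ?_, ?_⟩
  · rw [Finset.card_union_of_disjoint]
    · simp [hS, hT]
    · rw [Finset.disjoint_product]
      right
      simp [T]
  · have hsub : (S ×ˢ {0} ∪ {0} ×ˢ T) + C ×ˢ {0} ⊆ (S + C) ×ˢ {0} ∪ C ×ˢ T := by
      rw [Finset.union_add, Finset.product_add_product_comm, Finset.product_add_product_comm]
      simp only [Finset.singleton_zero, zero_add, add_zero, subset_refl]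
    have hSC : (S + C).card ≤ h * (l * a * a ^ (h - 1)) := by
      simpa [ZMod.card, hP] using card_piFinset_add_coordinateAxes_le (ι := Fin h) P
    have hC : C.card ≤ h * (l * a) := by
      simpa [ZMod.card] using card_coordinateAxes_le (ι := Fin h) (M := ZMod (l * a))
    calc _ ≤ ((S + C) ×ˢ {0} ∪ C ×ˢ T).card := Finset.card_le_card hsub
      _ ≤ (S + C).card + C.card * N := by
        refine (Finset.card_union_le _ _).trans ?_
        simp [hT]
      _ ≤ h * (l * a * a ^ (h - 1)) + h * (l * a) * N := by gcongr
      _ = (h + 1) * l * a ^ h := by rw [hpow, hN]; ring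
  · have hsub : (Finset.univ ×ˢ T : Finset ((Fin h → ZMod (l * a)) × ZMod (N + 1))) ⊆
        (S ×ˢ {0} ∪ {0} ×ˢ T) + iterSum (C ×ˢ {0}) h := by
      rintro ⟨x, t⟩ hxt
      refine Finset.mem_add.2 ⟨(0, t), ?_, (x, 0), ?_, by simp⟩
      · exact Finset.mem_union_right _ (by simpa using hxt)
      · simpa using mem_iterSum_coordinateAxes_product (H := ZMod (N + 1)) x
    refine le_trans ?_ (Finset.card_le_card hsub)
    rw [Finset.card_product, hT]
    simp only [Finset.card_univ, Fintype.card_fun, ZMod.card, Fintype.card_fin]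
    obtain ⟨m, hm⟩ := Nat.exists_eq_succ_of_ne_zero (pow_pos hb h).ne'
    rw [hm, Nat.succ_sub_one, Nat.succ_mul]
    omega
end
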